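/- arXiv:1201.4835 — 2 statements merged into one kernel-verified Lean document; each statement's English description precedes it below -/
import Mathlib

section
/- Let Ω ⊂ ℂ² be a bounded convex complete Reinhardt domain with C^∞-smooth boundary, i.e. Ω = {ρ < 0} for some real-valued C^∞ function ρ on a neighborhood of cl(Ω) whose gradient does not vanish on ∂Ω. If F = (f, g) : 𝔻 → ∂Ω is holomorphic, then f is constant or g is constant; that is, every analytic disk in ∂Ω is horizontal or vertical. -/
open MeasureTheory Metric Complex Filter Set Topology

/-- Every analytic disk in the boundary of a smooth bounded convex complete Reinhardt
domain in `ℂ²` is horizontal or vertical. -/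
theorem boundary_disk_horizontal_or_vertical
    (Ω : Set (ℂ × ℂ)) (hΩopen : IsOpen Ω) (hΩne : Ω.Nonempty)
    (hΩconv : Convex ℝ Ω) (hΩbdd : Bornology.IsBounded Ω)
    (hΩcomplete : ∀ p ∈ Ω, ∀ l₁ l₂ : ℂ, ‖l₁‖ ≤ 1 → ‖l₂‖ ≤ 1 →
      (l₁ * (Prod.fst p), l₂ * (Prod.snd p)) ∈ Ω)
    -- smooth defining function
    (V : Set (ℂ × ℂ)) (hVopen : IsOpen V) (hV : closure Ω ⊆ V)
    (ρ : ℂ × ℂ → ℝ) (hρ : ContDiffOn ℝ (⊤ : ℕ∞) ρ V)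
    (hΩρ : Ω = {p ∈ V | ρ p < 0})
    (hρgrad : ∀ p ∈ frontier Ω, fderiv ℝ ρ p ≠ 0)
    -- an analytic disk in the boundary
    (F : ℂ → ℂ × ℂ) (hF : DifferentiableOn ℂ F (ball (0:ℂ) 1))
    (hFbd : MapsTo F (ball (0:ℂ) 1) (frontier Ω)) :
    (∀ z ∈ ball (0:ℂ) 1, ∀ w ∈ ball (0:ℂ) 1, (F z).1 = (F w).1) ∨
    (∀ z ∈ ball (0:ℂ) 1, ∀ w ∈ ball (0:ℂ) 1, (F z).2 = (F w).2) := by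
  have h0 : (0:ℂ) ∈ ball (0:ℂ) 1 := by simp
  have hx : F 0 ∉ Ω := by
    have := hFbd h0
    rw [hΩopen.frontier_eq] at this
    exact this.2
  obtain ⟨L, hL⟩ := RCLike.geometric_hahn_banach_open_point (𝕜 := ℂ) hΩconv hΩopen hx
  obtain ⟨a, ha⟩ : ∃ a : ℂ, a = L (1, 0) := ⟨_, rfl⟩
  obtain ⟨b, hb⟩ : ∃ b : ℂ, b = L (0, 1) := ⟨_, rfl⟩
  have hLab : ∀ p : ℂ × ℂ, L p = a * p.1 + b * p.2 := by
    intro p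
    have : p = p.1 • ((1, 0) : ℂ × ℂ) + p.2 • ((0, 1) : ℂ × ℂ) := by
      ext <;> simp
    conv_lhs => rw [this]
    rw [map_add, map_smul, map_smul, ← ha, ← hb, smul_eq_mul, smul_eq_mul]
    ring
  have hL' : ∀ p ∈ Ω, ‖a * p.1‖ + ‖b * p.2‖ ≤ (L (F 0)).re := by
    intro p hp
    obtain ⟨c, hc, hc'⟩ := RCLike.exists_norm_eq_mul_self (a * p.1)
    obtain ⟨d, hd, hd'⟩ := RCLike.exists_norm_eq_mul_self (b * p.2)
    have h := (hL _ (hΩcomplete p hp c d hc.le hd.le)).le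
    rw [hLab] at h
    have e : a * (c * p.1) + b * (d * p.2) = ((‖a * p.1‖ + ‖b * p.2‖ : ℝ) : ℂ) := by
      have hc2 : ((‖a * p.1‖ : ℝ) : ℂ) = c * (a * p.1) := hc'
      have hd2 : ((‖b * p.2‖ : ℝ) : ℂ) = d * (b * p.2) := hd'
      rw [Complex.ofReal_add, hc2, hd2]; ring
    simp only [e] at h
    exact h
  have hcl : ∀ p ∈ closure Ω, ‖a * p.1‖ + ‖b * p.2‖ ≤ (L (F 0)).re := by
    have hclosed : IsClosed {p : ℂ × ℂ | ‖a * p.1‖ + ‖b * p.2‖ ≤ (L (F 0)).re} :=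
      isClosed_le (by fun_prop) continuous_const
    intro p hp
    exact closure_minimal (fun q hq => hL' q hq) hclosed hp
  have hFle : ∀ z ∈ ball (0:ℂ) 1, ‖a * (F z).1‖ + ‖b * (F z).2‖ ≤ (L (F 0)).re :=
    fun z hz => hcl _ (frontier_subset_closure (hFbd hz))
  have hLF : DifferentiableOn ℂ (fun z => Complex.exp (L (F z))) (ball (0:ℂ) 1) :=
    (L.differentiable.comp_differentiableOn hF).cexp
  have hre : ∀ z ∈ ball (0:ℂ) 1, (L (F z)).re = (L (F 0)).re := by
    have := Complex.norm_eqOn_of_isPreconnected_of_isMaxOn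
      (convex_ball (0:ℂ) 1).isPreconnected isOpen_ball hLF h0 (by
        intro z hz
        simp only [Function.comp, mem_setOf_eq, Complex.norm_exp, Real.exp_le_exp]
        refine le_trans ?_ (hFle z hz)
        rw [hLab, Complex.add_re]
        exact add_le_add (Complex.re_le_norm _) (Complex.re_le_norm _))
    intro z hz
    have h := this hz
    simpa [Complex.norm_exp] using h
  have hreal : ∀ z ∈ ball (0:ℂ) 1, (a * (F z).1).im = 0 ∧ (b * (F z).2).im = 0 := by
    intro z hz
    have h1 := hFle z hz
    rw [← hre z hz, hLab, Complex.add_re] at h1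
    have h2 := Complex.re_le_norm (a * (F z).1)
    have h3 := Complex.re_le_norm (b * (F z).2)
    have key : ∀ u : ℂ, u.re = ‖u‖ → u.im = 0 := by
      intro u hu
      have := Complex.sq_norm u
      rw [← hu, Complex.normSq_apply] at this
      nlinarith
    exact ⟨key _ (by linarith), key _ (by linarith)⟩
  have hconst : ∀ (c : ℂ) (f : ℂ → ℂ), c ≠ 0 → DifferentiableOn ℂ f (ball (0:ℂ) 1) →
      (∀ z ∈ ball (0:ℂ) 1, (c * f z).im = 0) →
      ∀ z ∈ ball (0:ℂ) 1, ∀ w ∈ ball (0:ℂ) 1, f z = f w := by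
    intro c f hc hf him z hz w hw
    have han : AnalyticOnNhd ℂ (fun z => c * f z) (ball (0:ℂ) 1) :=
      (hf.const_mul c).analyticOnNhd isOpen_ball
    obtain ⟨k, hk⟩ := han.eq_const_of_im_eq_const (c₀ := 0) him isOpen_ball
      (isConnected_ball (by norm_num))
    exact mul_left_cancel₀ hc ((hk z hz).trans (hk w hw).symm)
  by_cases ha0 : a = 0
  · by_cases hb0 : b = 0
    · obtain ⟨p, hp⟩ := hΩne
      have := hL p hp
      simp [hLab, ha0, hb0] at this
    · exact Or.inr (hconst b _ hb0 hF.snd fun z hz => (hreal z hz).2)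
  · exact Or.inl (hconst a _ ha0 hF.fst fun z hz => (hreal z hz).1)
end

section
/- Let φ, ψ : ℂ → ℂ be continuous, let f₁, f₂ be entire functions, and let r₀ > 0. For r > 0 define the Hankel operator on 𝔻_r by H^{𝔻_r}_φ(f) = φf − P^{𝔻_r}(φf). Then lim_{r → r₀} ⟨H^{𝔻_r}_φ(f₁), H^{𝔻_r}_ψ(f₂)⟩_{L²(𝔻_r)} = ⟨H^{𝔻_{r₀}}_φ(f₁), H^{𝔻_{r₀}}_ψ(f₂)⟩_{L²(𝔻_{r₀})}. -/
open MeasureTheory Metric Complex Filter Set Topology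

/-- The Bergman projection on the disk `𝔻_r`, given by the explicit Bergman kernel. -/
noncomputable def diskProj (r : ℝ) (u : ℂ → ℂ) (z : ℂ) : ℂ :=
  (1 / Real.pi) * ∫ ξ in ball (0:ℂ) r,
    (r:ℂ)^2 / ((r:ℂ)^2 - z * (starRingEnd ℂ) ξ)^2 * u ξ

/-- The Hankel operator on `𝔻_r` with symbol `φ`. -/
noncomputable def diskHankel (r : ℝ) (φ f : ℂ → ℂ) : ℂ → ℂ :=
  fun z => φ z * f z - diskProj r (fun ξ => φ ξ * f ξ) z

lemma aux_proj_scale (r : ℝ) (hr : 0 < r) (u : ℂ → ℂ) (w : ℂ) :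
    diskProj r u (r • w) = diskProj 1 (fun η => u (r • η)) w := by
  unfold diskProj
  congr 1
  have h := Measure.setIntegral_comp_smul_of_pos volume
    (fun ξ : ℂ => (r:ℂ)^2 / ((r:ℂ)^2 - (r • w) * (starRingEnd ℂ) ξ)^2 * u ξ)
    (ball (0:ℂ) 1) hr
  rw [smul_unitBall_of_pos hr, Complex.finrank_real_complex, eq_inv_smul_iff₀ (by positivity)] at h
  rw [← h, ← integral_smul]
  have hr' : (r:ℂ) ≠ 0 := by exact_mod_cast hr.ne'
  congr 1
  ext ξ
  simp only [Complex.real_smul, map_mul, Complex.conj_ofReal]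
  push_cast
  rw [show (r:ℂ)^2 - r * w * (r * (starRingEnd ℂ) ξ) = r^2 * (1^2 - w * (starRingEnd ℂ) ξ) by ring]
  rw [mul_pow, ← mul_assoc]
  congr 1
  by_cases h0 : (1:ℂ)^2 - w * (starRingEnd ℂ) ξ = 0
  · rw [h0]; simp
  · field_simp

lemma aux_hankel_scale (r : ℝ) (hr : 0 < r) (φ f : ℂ → ℂ) (w : ℂ) :
    diskHankel r φ f (r • w) =
      φ (r • w) * f (r • w) - diskProj 1 (fun η => φ (r • η) * f (r • η)) w := by
  unfold diskHankel
  rw [aux_proj_scale r hr]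

lemma aux_int_scale (r : ℝ) (hr : 0 < r) (F : ℂ → ℂ) :
    ∫ z in ball (0:ℂ) r, F z = (r^2 : ℝ) • ∫ w in ball (0:ℂ) 1, F (r • w) := by
  have h := Measure.setIntegral_comp_smul_of_pos volume F (ball (0:ℂ) 1) hr
  rw [smul_unitBall_of_pos hr, Complex.finrank_real_complex, eq_inv_smul_iff₀ (by positivity)] at h
  exact h.symm

lemma aux_int1 : IntegrableOn (fun w : ℂ => (1 - ‖w‖) ^ (-(1/2) : ℝ)) (ball 0 1) := by
  rw [integrableOn_fun_norm_addHaar volume (f := fun y : ℝ => (1 - y) ^ (-(1/2) : ℝ))]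
  have h1 : IntegrableOn (fun y : ℝ => (1 - y) ^ (-(1/2) : ℝ)) (Ioo 0 1) := by
    rw [← intervalIntegrable_iff_integrableOn_Ioo_of_le zero_le_one]
    have := (intervalIntegral.intervalIntegrable_rpow' (a := 0) (b := 1)
      (r := -(1/2)) (by norm_num)).comp_sub_left 1
    simpa using this.symm
  refine Integrable.mono h1 (Measurable.aestronglyMeasurable (by fun_prop)) ?_
  refine (ae_restrict_iff' measurableSet_Ioo).2 (ae_of_all _ fun y hy => ?_)
  rw [Complex.finrank_real_complex, norm_smul]
  refine mul_le_of_le_one_left (norm_nonneg _) ?_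
  rw [Real.norm_of_nonneg (by have := hy.1.le; positivity)]
  simpa using hy.2.le

lemma aux_int2 : IntegrableOn (fun w : ℂ => ‖w‖ ^ (-(7/4) : ℝ)) (ball 0 2) := by
  refine integrableOn_ball_of_norm_le_rpow (C := 1) (α := 7/4) ?_ ?_ ?_ ?_
  · simp [Complex.finrank_real_complex]
  · norm_num [Complex.finrank_real_complex]
  · refine ae_of_all _ fun x => ?_
    rw [Real.norm_of_nonneg (by positivity), one_mul]
  · exact Measurable.aestronglyMeasurable (by fun_prop)

lemma aux_norm (w ξ : ℂ) (hw : ‖w‖ < 1) (hξ : ‖ξ‖ < 1) :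
    ‖w - ξ‖ ≤ ‖1 - w * (starRingEnd ℂ) ξ‖ := by
  rw [← sq_le_sq₀ (norm_nonneg _) (norm_nonneg _)]
  have h1 : ‖w‖^2 < 1 := by nlinarith [norm_nonneg w]
  have h2 : ‖ξ‖^2 < 1 := by nlinarith [norm_nonneg ξ]
  rw [← Complex.normSq_eq_norm_sq] at *
  rw [← Complex.normSq_eq_norm_sq] at *
  simp only [Complex.normSq_apply, Complex.sub_re, Complex.sub_im, Complex.mul_re, Complex.mul_im,
    Complex.conj_re, Complex.conj_im, Complex.one_re, Complex.one_im] at *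
  nlinarith [mul_pos (sub_pos.2 h1) (sub_pos.2 h2)]

lemma aux_norm2 (w ξ : ℂ) (hξ : ‖ξ‖ < 1) :
    1 - ‖w‖ ≤ ‖1 - w * (starRingEnd ℂ) ξ‖ := by
  have h := norm_sub_norm_le (1:ℂ) (w * (starRingEnd ℂ) ξ)
  rw [norm_mul, RCLike.norm_conj, norm_one] at h
  nlinarith [norm_nonneg w]

lemma aux_ker_int (w : ℂ) (hw : ‖w‖ < 1) :
    IntegrableOn (fun ξ : ℂ => ‖((1:ℝ):ℂ)^2 / (((1:ℝ):ℂ)^2 - w * (starRingEnd ℂ) ξ)^2‖) (ball 0 1) := by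
  refine Measure.integrableOn_of_bounded (M := 1/(1-‖w‖)^2) measure_ball_lt_top.ne ?_ ?_
  · exact Measurable.aestronglyMeasurable (by fun_prop)
  · refine (ae_restrict_iff' measurableSet_ball).2 (ae_of_all _ fun ξ hξ => ?_)
    have := aux_norm2 w ξ (by simpa using hξ)
    have h0 : 0 < 1 - ‖w‖ := by linarith
    simp only [Complex.ofReal_one, one_pow, norm_norm, norm_div, norm_pow, norm_one]
    gcongr

lemma aux_ker_bound : ∃ C : ℝ, 0 ≤ C ∧ ∀ w : ℂ, ‖w‖ < 1 →
    ∫ ξ in ball (0:ℂ) 1, ‖((1:ℝ):ℂ)^2 / (((1:ℝ):ℂ)^2 - w * (starRingEnd ℂ) ξ)^2‖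
      ≤ C * (1 - ‖w‖) ^ (-(1/4) : ℝ) := by
  refine ⟨∫ η in ball (0:ℂ) 2, ‖η‖ ^ (-(7/4) : ℝ), integral_nonneg fun _ => by positivity, ?_⟩
  intro w hw
  have h0 : 0 < 1 - ‖w‖ := by linarith
  set g : ℂ → ℝ := indicator (ball 0 2) (fun η : ℂ => ‖η‖ ^ (-(7/4) : ℝ)) with hg
  have hgi : Integrable g := (integrable_indicator_iff measurableSet_ball).2 aux_int2
  have hg0 : ∀ x, 0 ≤ g x := fun x => indicator_nonneg (fun _ _ => by positivity) x
  have hgw : Integrable (fun ξ => g (w - ξ)) := hgi.comp_sub_left w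
  calc _ ≤ ∫ ξ in ball (0:ℂ) 1, g (w - ξ) * (1 - ‖w‖) ^ (-(1/4) : ℝ) := by
        refine integral_mono_ae (aux_ker_int w hw) (hgw.integrableOn.mul_const _) ?_
        have hne : ∀ᵐ ξ : ℂ ∂(volume.restrict (ball (0:ℂ) 1)), ξ ≠ w :=
          ae_restrict_of_ae (Measure.ae_ne volume w)
        filter_upwards [hne, ae_restrict_mem measurableSet_ball] with ξ h1 h2
        have hξ : ‖ξ‖ < 1 := by simpa using h2
        have hpos : 0 < ‖w - ξ‖ := norm_pos_iff.2 (sub_ne_zero.2 h1.symm)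
        have hA := aux_norm w ξ hw hξ
        have hB := aux_norm2 w ξ hξ
        have hmem : w - ξ ∈ ball (0:ℂ) 2 := by
          have := norm_sub_le w ξ
          simp only [mem_ball, dist_zero_right]; linarith
        rw [hg, indicator_of_mem hmem]
        simp only [Complex.ofReal_one, one_pow, norm_div, norm_pow, norm_one]
        set t := ‖1 - w * (starRingEnd ℂ) ξ‖
        have ht : 0 < t := by linarith
        have : 1 / t^2 = t ^ (-(7/4) : ℝ) * t ^ (-(1/4) : ℝ) := by
          rw [← Real.rpow_add ht, show (-(7/4) + -(1/4) : ℝ) = -((2:ℕ):ℝ) by norm_num,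
            Real.rpow_neg ht.le, Real.rpow_natCast, one_div]
        rw [this]
        exact mul_le_mul (Real.rpow_le_rpow_of_nonpos hpos hA (by norm_num))
          (Real.rpow_le_rpow_of_nonpos h0 hB (by norm_num)) (by positivity) (by positivity)
    _ = (∫ ξ in ball (0:ℂ) 1, g (w - ξ)) * (1 - ‖w‖) ^ (-(1/4) : ℝ) := integral_mul_const _ _
    _ ≤ _ := by
        refine mul_le_mul_of_nonneg_right ?_ (by positivity)
        calc _ ≤ ∫ ξ, g (w - ξ) := setIntegral_le_integral hgw (ae_of_all _ fun _ => hg0 _)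
          _ = ∫ ξ, g ξ := integral_sub_left_eq_self g volume w
          _ = _ := integral_indicator measurableSet_ball

/-- a bound for the unit disk projection -/
lemma aux_proj_bound : ∃ C : ℝ, 0 ≤ C ∧ ∀ (v : ℂ → ℂ) (M : ℝ), 0 ≤ M →
    (∀ ξ, ‖ξ‖ < 1 → ‖v ξ‖ ≤ M) → ∀ w : ℂ, ‖w‖ < 1 →
    ‖diskProj 1 v w‖ ≤ M * (C * (1 - ‖w‖) ^ (-(1/4) : ℝ)) := by
  obtain ⟨C, hC, h⟩ := aux_ker_bound
  refine ⟨C, hC, fun v M hM hv w hw => ?_⟩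
  unfold diskProj
  rw [norm_mul]
  have h1 : ‖(1 / Real.pi : ℂ)‖ ≤ 1 := by
    rw [norm_div, norm_one, Complex.norm_real, Real.norm_of_nonneg Real.pi_pos.le,
      div_le_one Real.pi_pos]
    linarith [Real.pi_gt_three]
  refine (mul_le_of_le_one_left (norm_nonneg _) h1).trans ?_
  refine (norm_integral_le_of_norm_le ((aux_ker_int w hw).const_mul M) ?_).trans ?_
  · refine (ae_restrict_iff' measurableSet_ball).2 (ae_of_all _ fun ξ hξ => ?_)
    rw [norm_mul, mul_comm]
    exact mul_le_mul_of_nonneg_right (hv ξ (by simpa using hξ)) (norm_nonneg _)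
  · rw [integral_const_mul]
    exact mul_le_mul_of_nonneg_left (h w hw) hM

lemma aux_bdd (u : ℂ → ℂ) (hu : Continuous u) (r₀ : ℝ) (hr₀ : 0 < r₀) :
    ∃ M : ℝ, 0 ≤ M ∧ ∀ᶠ r in 𝓝 r₀, ∀ ξ : ℂ, ‖ξ‖ < 1 → ‖u (r • ξ)‖ ≤ M := by
  obtain ⟨M, hM⟩ := (isCompact_closedBall (0:ℂ) (2*r₀)).exists_bound_of_continuousOn hu.continuousOn
  refine ⟨M, (norm_nonneg _).trans (hM 0 (by simp [hr₀.le])), ?_⟩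
  filter_upwards [Ioo_mem_nhds hr₀ (show r₀ < 2 * r₀ by linarith)] with r hr ξ hξ
  refine hM _ ?_
  rw [mem_closedBall, dist_zero_right, norm_smul, Real.norm_of_nonneg hr.1.le]
  nlinarith [hr.1, hr.2, norm_nonneg ξ]

lemma aux_proj_tendsto (u : ℂ → ℂ) (hu : Continuous u) (r₀ : ℝ) (hr₀ : 0 < r₀)
    (w : ℂ) (hw : ‖w‖ < 1) :
    Tendsto (fun r : ℝ => diskProj 1 (fun η => u (r • η)) w) (𝓝 r₀)
      (𝓝 (diskProj 1 (fun η => u (r₀ • η)) w)) := by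
  obtain ⟨M, hM, hb⟩ := aux_bdd u hu r₀ hr₀
  unfold diskProj
  refine Tendsto.const_mul _ ?_
  refine tendsto_integral_filter_of_dominated_convergence _ ?_ ?_
    ((aux_ker_int w hw).const_mul M) ?_
  · refine Eventually.of_forall fun r => Measurable.aestronglyMeasurable ?_
    have := hu.measurable
    fun_prop
  · filter_upwards [hb] with r hr
    refine (ae_restrict_iff' measurableSet_ball).2 (ae_of_all _ fun ξ hξ => ?_)
    rw [norm_mul, mul_comm]
    exact mul_le_mul_of_nonneg_right (hr ξ (by simpa using hξ)) (norm_nonneg _)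
  · refine ae_of_all _ fun ξ => Tendsto.const_mul _ ?_
    exact Continuous.tendsto (by fun_prop : Continuous fun r : ℝ => u (r • ξ)) r₀

lemma aux_proj_meas (v : ℂ → ℂ) (hv : Continuous v) : Measurable (diskProj 1 v) := by
  unfold diskProj
  refine Measurable.const_mul ?_ _
  refine (StronglyMeasurable.integral_prod_right (f := fun z ξ : ℂ =>
    ((1:ℝ):ℂ)^2 / (((1:ℝ):ℂ)^2 - z * (starRingEnd ℂ) ξ)^2 * v ξ) ?_).measurable
  refine Measurable.stronglyMeasurable ?_
  have := hv.measurable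
  unfold Function.uncurry
  fun_prop

lemma aux_main (u v : ℂ → ℂ) (hu : Continuous u) (hv : Continuous v) (r₀ : ℝ) (hr₀ : 0 < r₀) :
    Tendsto (fun r : ℝ => ∫ w in ball (0:ℂ) 1,
        (u (r • w) - diskProj 1 (fun η => u (r • η)) w) *
          (starRingEnd ℂ) (v (r • w) - diskProj 1 (fun η => v (r • η)) w))
      (𝓝 r₀)
      (𝓝 (∫ w in ball (0:ℂ) 1,
        (u (r₀ • w) - diskProj 1 (fun η => u (r₀ • η)) w) *
          (starRingEnd ℂ) (v (r₀ • w) - diskProj 1 (fun η => v (r₀ • η)) w))) := by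
  obtain ⟨C, hC, hP⟩ := aux_proj_bound
  obtain ⟨M, hM, hMb⟩ := aux_bdd u hu r₀ hr₀
  obtain ⟨N, hN, hNb⟩ := aux_bdd v hv r₀ hr₀
  refine tendsto_integral_filter_of_dominated_convergence
    (fun w => (M * N * 2) * (1 + C^2 * (1 - ‖w‖) ^ (-(1/2) : ℝ))) ?_ ?_ ?_ ?_
  · refine Eventually.of_forall fun r => Measurable.aestronglyMeasurable ?_
    have h1 := aux_proj_meas (fun η => u (r • η)) (by fun_prop)
    have h2 := aux_proj_meas (fun η => v (r • η)) (by fun_prop)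
    have := hu.measurable
    have := hv.measurable
    have h3 : Measurable (starRingEnd ℂ) := Complex.continuous_conj.measurable
    exact Measurable.mul (Measurable.sub (by fun_prop) h1)
      (h3.comp (Measurable.sub (by fun_prop) h2))
  · filter_upwards [hMb, hNb] with r h1 h2
    refine (ae_restrict_iff' measurableSet_ball).2 (ae_of_all _ fun w hw => ?_)
    have hw : ‖w‖ < 1 := by simpa using hw
    have h0 : 0 < 1 - ‖w‖ := by linarith
    have hsq : (1 - ‖w‖) ^ (-(1/2) : ℝ) = ((1 - ‖w‖) ^ (-(1/4) : ℝ))^2 := by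
      rw [← Real.rpow_natCast, ← Real.rpow_mul h0.le]; norm_num
    rw [hsq]
    set G := (1 - ‖w‖) ^ (-(1/4) : ℝ)
    have hG : 0 ≤ G := by positivity
    have hCG : 0 ≤ C * G := by positivity
    rw [norm_mul, RCLike.norm_conj]
    have e1 : ‖u (r • w) - diskProj 1 (fun η => u (r • η)) w‖ ≤ M * (1 + C * G) := by
      refine (norm_sub_le _ _).trans ?_
      have := hP (fun η => u (r • η)) M hM h1 w hw
      linarith [h1 w hw]
    have e2 : ‖v (r • w) - diskProj 1 (fun η => v (r • η)) w‖ ≤ N * (1 + C * G) := by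
      refine (norm_sub_le _ _).trans ?_
      have := hP (fun η => v (r • η)) N hN h2 w hw
      linarith [h2 w hw]
    calc _ ≤ (M * (1 + C * G)) * (N * (1 + C * G)) :=
          mul_le_mul e1 e2 (norm_nonneg _) (by positivity)
      _ = (M * N) * (1 + C * G)^2 := by ring
      _ ≤ (M * N) * (2 * (1 + C^2 * G^2)) := by
          refine mul_le_mul_of_nonneg_left ?_ (by positivity)
          nlinarith [sq_nonneg (1 - C * G)]
      _ = _ := by ring
  · refine Integrable.const_mul (Integrable.add ?_ (Integrable.const_mul aux_int1 _)) _
    exact integrableOn_const measure_ball_lt_top.ne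
  · refine (ae_restrict_iff' measurableSet_ball).2 (ae_of_all _ fun w hw => ?_)
    have hw : ‖w‖ < 1 := by simpa using hw
    refine Tendsto.mul (Tendsto.sub ?_ (aux_proj_tendsto u hu r₀ hr₀ w hw))
      ((Complex.continuous_conj.tendsto _).comp
        (Tendsto.sub ?_ (aux_proj_tendsto v hv r₀ hr₀ w hw)))
    · exact Continuous.tendsto (by fun_prop : Continuous fun r : ℝ => u (r • w)) r₀
    · exact Continuous.tendsto (by fun_prop : Continuous fun r : ℝ => v (r • w)) r₀

/-- `⟨H^{𝔻_r}_φ f₁, H^{𝔻_r}_ψ f₂⟩_{𝔻_r} → ⟨H^{𝔻_{r₀}}_φ f₁, H^{𝔻_{r₀}}_ψ f₂⟩_{𝔻_{r₀}}`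
as `r → r₀`. -/
theorem hankel_inner_products_converge
    (φ ψ : ℂ → ℂ) (hφ : Continuous φ) (hψ : Continuous ψ)
    (f₁ f₂ : ℂ → ℂ) (hf₁ : Differentiable ℂ f₁) (hf₂ : Differentiable ℂ f₂)
    (r₀ : ℝ) (hr₀ : 0 < r₀) :
    Tendsto (fun r : ℝ => ∫ z in ball (0:ℂ) r,
        diskHankel r φ f₁ z * (starRingEnd ℂ) (diskHankel r ψ f₂ z))
      (𝓝 r₀)
      (𝓝 (∫ z in ball (0:ℂ) r₀,
        diskHankel r₀ φ f₁ z * (starRingEnd ℂ) (diskHankel r₀ ψ f₂ z))) := by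

  have key : ∀ r : ℝ, 0 < r → ∫ z in ball (0:ℂ) r,
        diskHankel r φ f₁ z * (starRingEnd ℂ) (diskHankel r ψ f₂ z) =
      (r^2 : ℝ) • ∫ w in ball (0:ℂ) 1,
        (φ (r • w) * f₁ (r • w) - diskProj 1 (fun η => φ (r • η) * f₁ (r • η)) w) *
          (starRingEnd ℂ) (ψ (r • w) * f₂ (r • w) -
            diskProj 1 (fun η => ψ (r • η) * f₂ (r • η)) w) := by
    intro r hr
    rw [aux_int_scale r hr]
    simp only [aux_hankel_scale r hr]
  have hm := aux_main (fun z => φ z * f₁ z) (fun z => ψ z * f₂ z)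
    (hφ.mul hf₁.continuous) (hψ.mul hf₂.continuous) r₀ hr₀
  rw [key r₀ hr₀]
  refine Tendsto.congr' ?_ (Tendsto.smul
    (Continuous.tendsto (by fun_prop : Continuous fun r : ℝ => r^2) r₀) hm)
  filter_upwards [Ioi_mem_nhds hr₀] with r hr
  exact (key r hr).symm
end
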